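/- Let n >= 1 and let q = p^h with p prime. Let pi be an n-dimensional projective subspace of PG(2n+1,q^2) and let alpha be an element of F_p. Then alpha*(v_pi - v_{pi^sigma}) is a code word of the dual code C_n(H(2n+1,q^2))^perp; equivalently, for every generator mu of H(2n+1,q^2), the number of points of mu lying on pi is congruent modulo p to the number of points of mu lying on pi^sigma. -/

import Mathlib

open scoped BigOperators

namespace HermCode

/-- The Hermitian sesquilinear form `h(x,y) = ∑ᵢ xᵢ * yᵢ^q` on `F^m`. -/
def herm (q : ℕ) {F : Type} [Field F] {m : ℕ} (x y : Fin m → F) : F :=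
  ∑ i, x i * (y i) ^ q

/-- For a fixed vector `x`, the linear map `y ↦ h(y,x)`. -/
def hermL (q : ℕ) {F : Type} [Field F] {m : ℕ} (x : Fin m → F) :
    (Fin m → F) →ₗ[F] F where
  toFun y := herm q y x
  map_add' a b := by
    simp [herm, add_mul, Finset.sum_add_distrib]
  map_smul' c a := by
    simp [herm, Finset.mul_sum, mul_assoc]

/-- The image `W^σ` of a subspace `W` under the Hermitian polarity `σ`:
the subspace of all vectors orthogonal to every vector of `W`
with respect to the Hermitian form. -/
def polar (q : ℕ) {F : Type} [Field F] {m : ℕ} (W : Submodule F (Fin m → F)) :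
    Submodule F (Fin m → F) :=
  ⨅ x : W, LinearMap.ker (hermL q (x : Fin m → F))

/-- A subspace all of whose points lie on the Hermitian variety. -/
def TotallyIsotropic (q : ℕ) {F : Type} [Field F] {m : ℕ}
    (W : Submodule F (Fin m → F)) : Prop :=
  ∀ x ∈ W, herm q x x = 0

/-- A point of the Hermitian variety: a projective point (1-dimensional subspace)
spanned by an isotropic vector. -/
def IsHermPoint (q : ℕ) {F : Type} [Field F] {m : ℕ}
    (P : Submodule F (Fin m → F)) : Prop :=
  Module.finrank F P = 1 ∧ TotallyIsotropic q P

/-- A generator of `H(2n+1,q²)`: an `n`-dimensional projective subspace all of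
whose points lie on the Hermitian variety. -/
def IsGenerator (q n : ℕ) {F : Type} [Field F]
    (W : Submodule F (Fin (2*n+2) → F)) : Prop :=
  Module.finrank F W = n + 1 ∧ TotallyIsotropic q W

/-- A code word of the dual code `C_n(H(2n+1,q²))^⊥`: a function from points to `F_p`
(vanishing off the Hermitian variety) summing to zero over every generator. -/
def IsCodeword (p q n : ℕ) {F : Type} [Field F]
    (c : Submodule F (Fin (2*n+2) → F) → ZMod p) : Prop :=
  (∀ P, ¬ IsHermPoint q P → c P = 0) ∧
  ∀ μ, IsGenerator q n μ → (∑ᶠ P ∈ {P | IsHermPoint q P ∧ P ≤ μ}, c P) = 0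

/-- The (Hamming) weight of a code word. -/
noncomputable def wt {p : ℕ} {α : Type*} (c : α → ZMod p) : ℕ :=
  Nat.card {x : α // c x ≠ 0}

open scoped Classical in
/-- The incidence vector `v_π` of `π ∩ H`. -/
noncomputable def vsub (p q : ℕ) {F : Type} [Field F] {m : ℕ}
    (π : Submodule F (Fin m → F)) : Submodule F (Fin m → F) → ZMod p :=
  fun P => if IsHermPoint q P ∧ P ≤ π then 1 else 0

/-- `θ_m(q)`, the number of points of `PG(m,q)`. -/
noncomputable def theta (q : ℕ) (m : ℤ) : ℚ :=
  ((q:ℚ)^(m+1) - 1) / ((q:ℚ) - 1)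

/-- `μ_m(q²)`, the number of points of `H(m,q²)` (with `μ_{-1} = 0`). -/
noncomputable def muH (q : ℕ) (m : ℤ) : ℚ :=
  (((q:ℚ)^(m+1) - (-1:ℚ)^(m+1)) * ((q:ℚ)^m - (-1:ℚ)^m)) / ((q:ℚ)^2 - 1)

/-- The number `N(n,i)`. -/
noncomputable def NN (q n : ℕ) (i : ℤ) : ℚ :=
  (q:ℚ)^(((n:ℤ)-1)^2 - ((((n:ℤ)-i-1).toNat.choose 2 : ℕ) : ℤ)) *
    ∏ j ∈ Finset.range ((n:ℤ)-i-2).toNat, ((q:ℚ)^(j+1) - (-1:ℚ)^(j+1))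

open scoped Classical in
/-- The quantity `Σ_{n,i}`. -/
noncomputable def SigmaNI (q n : ℕ) (i : ℤ) : ℚ :=
  if Odd ((n:ℤ) - i) then
    2*(q:ℚ)^(2*i+2) * muH q ((n:ℤ)-i-1)
      + 4 * muH q ((n:ℤ)-i-2) * ((q:ℚ)^((n:ℤ)-i-1) - 1)
          / ((q:ℚ)^((n:ℤ)-3*i-5) * ((q:ℚ)^2 - 1))
  else
    2*(q:ℚ)^(2*i+2) * (muH q ((n:ℤ)-i-1)
      + 2*((q:ℚ)^(4:ℤ) * muH q ((n:ℤ)-i-3) + (q:ℚ)^2 - 1)/((q:ℚ)^2 - 1))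

/-- `P` lies on a projective line entirely contained in the Hermitian variety that
meets both `π \ (π ⊓ π^σ)` and `π^σ \ (π ⊓ π^σ)`. -/
def OnGoodLine (q : ℕ) {F : Type} [Field F] {m : ℕ}
    (π P : Submodule F (Fin m → F)) : Prop :=
  ∃ A B : Submodule F (Fin m → F),
    Module.finrank F A = 1 ∧ A ≤ π ∧ ¬ A ≤ π ⊓ polar q π ∧
    Module.finrank F B = 1 ∧ B ≤ polar q π ∧ ¬ B ≤ π ⊓ polar q π ∧
    P ≤ A ⊔ B ∧ TotallyIsotropic q (A ⊔ B)

section Aux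

variable {F : Type} [Field F]

theorem mem_polar {q m : ℕ} {W : Submodule F (Fin m → F)} {y : Fin m → F} :
    y ∈ polar q W ↔ ∀ x ∈ W, herm q y x = 0 := by
  simp only [polar, Submodule.mem_iInf, LinearMap.mem_ker, Subtype.forall]
  exact Iff.rfl

/-- Semilinear coordinatewise Frobenius power. -/
def frobS (p k m : ℕ) [Fact p.Prime] [CharP F p] :
    (Fin m → F) →ₛₗ[iterateFrobenius F p k] (Fin m → F) where
  toFun x := fun i => iterateFrobenius F p k (x i)
  map_add' a b := by ext i; simp
  map_smul' c a := by ext i; simp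

theorem finrank_polar (p k m : ℕ) [Fact p.Prime] [CharP F p] [Finite F]
    (W : Submodule F (Fin m → F)) :
    Module.finrank F (polar (p ^ k) W) = m - Module.finrank F W := by
  have : RingHomSurjective (iterateFrobenius F p k) :=
    ⟨Finite.surjective_of_injective (iterateFrobenius F p k).injective⟩
  have hinj : Function.Injective (frobS (F := F) p k m) := by
    intro a b hab
    ext i
    exact (iterateFrobenius F p k).injective (congrFun hab i)
  let B : LinearMap.BilinForm F (Fin m → F) := Matrix.toBilin' 1
  have hB : B.Nondegenerate := by
    apply Matrix.Nondegenerate.toBilin'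
    exact Matrix.nondegenerate_of_det_ne_zero (by simp)
  have hpol : polar (p ^ k) W = B.orthogonal (W.map (frobS p k m)) := by
    ext y
    rw [mem_polar, LinearMap.BilinForm.mem_orthogonal_iff]
    simp only [Submodule.mem_map, forall_exists_index, and_imp, forall_apply_eq_imp_iff₂]
    refine forall₂_congr fun x hx => ?_
    simp only [B, Matrix.toBilin'_apply', Matrix.one_mulVec]
    simp [herm, dotProduct, frobS, iterateFrobenius_def, mul_comm]
  have hc : Module.finrank F (W.map (frobS p k m)) = Module.finrank F W := by
    have h1 := Module.natCard_eq_pow_finrank (K := F) (V := W)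
    have h2 := Module.natCard_eq_pow_finrank (K := F) (V := W.map (frobS p k m))
    have h3 : Nat.card (W.map (frobS p k m)) = Nat.card W := by
      have := Set.ncard_image_of_injective (W : Set (Fin m → F)) hinj
      rw [← Submodule.map_coe] at this
      exact this
    rw [h1, h2] at h3
    exact Nat.pow_right_injective (Finite.one_lt_card (α := F)) h3
  rw [hpol, LinearMap.BilinForm.finrank_orthogonal hB, hc]
  simp

theorem herm_eq_zero (p k m : ℕ) [Fact p.Prime] [CharP F p] [Fintype F] (hk : 1 ≤ k)
    (hF : Fintype.card F = (p ^ k) ^ 2)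
    {W : Submodule F (Fin m → F)} (hW : TotallyIsotropic (p ^ k) W)
    {x y : Fin m → F} (hx : x ∈ W) (hy : y ∈ W) : herm (p ^ k) x y = 0 := by
  have hp1 : 1 < p ^ k := Nat.one_lt_pow (by omega) (Fact.out : p.Prime).one_lt
  by_contra ha
  have key : ∀ c : F, c * herm (p ^ k) y x + c ^ (p ^ k) * herm (p ^ k) x y = 0 := by
    intro c
    have h0 := hW _ (W.add_mem hx (W.smul_mem c hy))
    have e : herm (p ^ k) (x + c • y) (x + c • y) = herm (p ^ k) x x
        + (c * herm (p ^ k) y x + c ^ (p ^ k) * herm (p ^ k) x y)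
        + c * c ^ (p ^ k) * herm (p ^ k) y y := by
      simp only [herm, Finset.mul_sum, ← Finset.sum_add_distrib]
      refine Finset.sum_congr rfl fun i _ => ?_
      simp only [Pi.add_apply, Pi.smul_apply, smul_eq_mul, add_pow_char_pow, mul_pow]
      ring
    rw [e, hW x hx, hW y hy] at h0
    simpa using h0
  have h1 := key 1
  have hfix : ∀ c : F, c ^ (p ^ k) = c := by
    intro c
    have := key c
    have h2 : (c ^ (p ^ k) - c) * herm (p ^ k) x y = 0 := by
      simp only [one_mul, one_pow] at h1
      linear_combination this - c * h1
    exact sub_eq_zero.1 ((mul_eq_zero.1 h2).resolve_right ha)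
  have hne := FiniteField.X_pow_card_sub_X_ne_zero F hp1
  have hdeg := FiniteField.X_pow_card_sub_X_natDegree_eq F hp1
  have := Polynomial.card_le_degree_of_subset_roots
    (p := (Polynomial.X ^ (p ^ k) - Polynomial.X : Polynomial F)) (Z := Finset.univ) (by
      intro c _
      rw [Polynomial.mem_roots hne]
      simp [hfix])
  rw [hdeg, Finset.card_univ, hF] at this
  nlinarith

/-- The set of projective points of a subspace. -/
def pts {m : ℕ} (A : Submodule F (Fin m → F)) : Set (Submodule F (Fin m → F)) :=
  {P | Module.finrank F P = 1 ∧ P ≤ A}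

theorem pts_ncard {m : ℕ} (A : Submodule F (Fin m → F)) :
    (pts A).ncard = {Q : Submodule F A | Module.finrank F Q = 1}.ncard := by
  rw [← Set.ncard_image_of_injective _ (Submodule.map_injective_of_injective A.subtype_injective)]
  congr 1
  ext P
  constructor
  · rintro ⟨h1, h2⟩
    have e : (P.comap A.subtype).map A.subtype = P := by
      rw [Submodule.map_comap_subtype, inf_eq_right.2 h2]
    refine ⟨P.comap A.subtype, ?_, e⟩
    rw [Set.mem_ofPred_eq, ← Submodule.finrank_map_subtype_eq, e, h1]
  · rintro ⟨Q, hQ, rfl⟩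
    refine ⟨?_, Submodule.map_subtype_le _ _⟩
    rw [Submodule.finrank_map_subtype_eq]
    exact hQ

theorem pts_ncard_eq {m : ℕ} {A B : Submodule F (Fin m → F)}
    (h : Module.finrank F A = Module.finrank F B) : (pts A).ncard = (pts B).ncard := by
  rw [pts_ncard, pts_ncard]
  let e := LinearEquiv.ofFinrankEq A B h
  rw [← Set.ncard_image_of_injective _ (Submodule.map_injective_of_injective e.injective)]
  congr 1
  ext P
  constructor
  · rintro ⟨Q, hQ, rfl⟩
    exact (LinearEquiv.finrank_map_eq e Q).trans hQ
  · intro hP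
    refine ⟨P.map (e.symm : B →ₗ[F] A), (LinearEquiv.finrank_map_eq e.symm P).trans hP, ?_⟩
    rw [← Submodule.map_comp]
    simp

theorem sum_vsub {p q m : ℕ} [Finite F] {μ : Submodule F (Fin m → F)}
    (hμ : TotallyIsotropic q μ) (W : Submodule F (Fin m → F)) :
    (∑ᶠ P ∈ {P | IsHermPoint q P ∧ P ≤ μ}, vsub p q W P) = ((pts (μ ⊓ W)).ncard : ZMod p) := by
  classical
  letI : Fintype (Submodule F (Fin m → F)) := Fintype.ofFinite _
  rw [finsum_mem_eq_finite_toFinset_sum _ (Set.toFinite _)]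
  simp only [vsub, Finset.sum_boole]
  rw [Set.ncard_eq_toFinset_card']
  congr 2
  ext P
  rw [Finset.mem_filter, Set.Finite.mem_toFinset, Set.mem_toFinset]
  change ((Module.finrank F P = 1 ∧ TotallyIsotropic q P) ∧ P ≤ μ) ∧
    (Module.finrank F P = 1 ∧ TotallyIsotropic q P) ∧ P ≤ W ↔ Module.finrank F P = 1 ∧ P ≤ μ ⊓ W
  rw [le_inf_iff]
  constructor
  · tauto
  · rintro ⟨h1, h2, h3⟩
    have : TotallyIsotropic q P := fun x hx => hμ x (h2 hx)
    tauto

end Aux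

/-- `α • (v_π - v_(π^σ))` is a code word of `C_n(H(2n+1,q²))^⊥`. -/
theorem stmt2 (n q p hh : ℕ) (hn : 1 ≤ n) (hp : p.Prime) (hh1 : 1 ≤ hh)
    (hq : q = p ^ hh)
    (F : Type) [Field F] [Fintype F] (hF : Fintype.card F = q ^ 2)
    (π : Submodule F (Fin (2*n+2) → F)) (hπ : Module.finrank F π = n + 1)
    (α : ZMod p) :
    IsCodeword p q n
      (fun P => α * (vsub p q π P - vsub p q (polar q π) P)) := by
  subst hq
  have : Fact p.Prime := ⟨hp⟩
  have : CharP F p := charP_of_card_eq_prime_pow (f := hh * 2) (by rw [hF, pow_mul])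
  constructor
  · intro P hP
    simp [vsub, hP]
  · rintro μ ⟨hμ1, hμ2⟩
    have hself : polar (p ^ hh) μ = μ := by
      symm
      apply Submodule.eq_of_le_of_finrank_eq
      · intro y hy
        rw [mem_polar]
        intro x hx
        exact herm_eq_zero p hh _ hh1 hF hμ2 hy hx
      · rw [finrank_polar, hμ1]
        omega
    have hsup : polar (p ^ hh) (μ ⊔ π) = μ ⊓ polar (p ^ hh) π := by
      conv_rhs => rw [← hself]
      ext y
      rw [Submodule.mem_inf]
      constructor
      · intro h
        rw [mem_polar] at h
        exact ⟨mem_polar.2 fun x hx => h x (Submodule.mem_sup_left hx),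
          mem_polar.2 fun x hx => h x (Submodule.mem_sup_right hx)⟩
      · rintro ⟨h1, h2⟩
        rw [mem_polar] at h1 h2 ⊢
        intro x hx
        obtain ⟨a, ha, b, hb, rfl⟩ := Submodule.mem_sup.1 hx
        have : herm (p ^ hh) y (a + b) = herm (p ^ hh) y a + herm (p ^ hh) y b := by
          simp [herm, add_pow_char_pow, mul_add, Finset.sum_add_distrib]
        rw [this, h1 a ha, h2 b hb, add_zero]
    have hdim : Module.finrank F (μ ⊓ π : Submodule F (Fin (2*n+2) → F))
        = Module.finrank F (μ ⊓ polar (p ^ hh) π : Submodule F (Fin (2*n+2) → F)) := by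
      rw [← hsup, finrank_polar]
      have := Submodule.finrank_sup_add_finrank_inf_eq μ π
      omega
    rw [← mul_finsum_mem, finsum_mem_sub_distrib _ _ (Set.toFinite _), sum_vsub hμ2, sum_vsub hμ2,
      pts_ncard_eq hdim, sub_self, mul_zero]

end HermCode
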